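/- Let G be a finite insoluble group. Then |Sol_G(x)| ≥ 10 for all elements x ∈ G. -/

import Mathlib

def Sol {G : Type*} [Group G] (x : G) : Set G :=
  {y | IsSolvable ↥(Subgroup.closure {x, y})}

open scoped MonoidAlgebra

theorem trace_pi_matrix {k : ℕ} (d : Fin k → ℕ)
    (m : (i : Fin k) → Matrix (Fin (d i)) (Fin (d i)) ℂ) :
    LinearMap.trace ℂ _ (LinearMap.mulLeft ℂ m) = ∑ i, (d i : ℂ) * (m i).trace := by
  classical
  rw [LinearMap.trace_eq_matrix_trace ℂ
    (Pi.basis fun i => Matrix.stdBasis ℂ (Fin (d i)) (Fin (d i)))]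
  rw [Matrix.trace, Fintype.sum_sigma]
  refine Finset.sum_congr rfl fun i _ => ?_
  rw [Fintype.sum_prod_type]
  have : ∀ a b, (LinearMap.toMatrix (Pi.basis fun i => Matrix.stdBasis ℂ (Fin (d i)) (Fin (d i)))
      (Pi.basis fun i => Matrix.stdBasis ℂ (Fin (d i)) (Fin (d i)))
      (LinearMap.mulLeft ℂ m)).diag ⟨i, (a, b)⟩ = m i a a := by
    intro a b
    rw [Matrix.diag_apply, LinearMap.toMatrix_apply, Pi.basis_repr]
    simp only [Matrix.stdBasis, Pi.basis_apply, LinearMap.mulLeft_apply, Pi.mul_apply, Pi.single_eq_same]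
    simp [Matrix.mul_apply]
    rw [Finset.sum_eq_single a]
    · simp
    · intro j _ hj
      simp [Pi.single_eq_of_ne hj]
    · simp
  simp only [this]
  simp [Matrix.trace, Finset.mul_sum]

theorem trace_regular {G : Type*} [Group G] [Fintype G] (a : MonoidAlgebra ℂ G) :
    LinearMap.trace ℂ _ (LinearMap.mulLeft ℂ a) = (Fintype.card G : ℂ) * a.coeff 1 := by
  classical
  rw [LinearMap.trace_eq_matrix_trace ℂ (MonoidAlgebra.basis G ℂ)]
  rw [Matrix.trace]
  have : ∀ g, (LinearMap.toMatrix (MonoidAlgebra.basis G ℂ) (MonoidAlgebra.basis G ℂ)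
      (LinearMap.mulLeft ℂ a)).diag g = a.coeff 1 := by
    intro g
    rw [Matrix.diag_apply, LinearMap.toMatrix_apply]
    rw [LinearMap.mulLeft_apply, MonoidAlgebra.basis_apply]
    change (a * MonoidAlgebra.single g 1).coeff g = _
    simp
  simp only [this]
  simp

theorem trace_formula {G : Type*} [Group G] [Fintype G] {k : ℕ} (d : Fin k → ℕ)
    (φ : MonoidAlgebra ℂ G ≃ₐ[ℂ] ((i : Fin k) → Matrix (Fin (d i)) (Fin (d i)) ℂ))
    (a : MonoidAlgebra ℂ G) :
    ∑ i, (d i : ℂ) * (φ a i).trace = (Fintype.card G : ℂ) * a.coeff 1 := by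
  rw [← trace_pi_matrix, ← trace_regular, ← LinearMap.trace_conj' _ φ.toLinearEquiv]
  congr 1
  refine LinearMap.ext fun m => ?_
  simp [LinearEquiv.conj_apply]

theorem trace_int {n : ℕ} (M : Matrix (Fin n) (Fin n) ℂ) (h3 : M ^ 3 = 1)
    (h : (M ^ 2).trace = M.trace) : ∃ c : ℤ, M.trace = c := by
  obtain ⟨w, hw⟩ : ∃ w : ℂ, w ^ 2 + w + 1 = 0 := by
    obtain ⟨w, hw⟩ := IsAlgClosed.exists_root (Polynomial.X ^ 2 + Polynomial.X + 1 : Polynomial ℂ)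
      (by rw [show (Polynomial.X ^ 2 + Polynomial.X + 1 : Polynomial ℂ).degree = 2 by compute_degree!]; decide)
    exact ⟨w, by simpa using hw⟩
  have hw3 : w ^ 3 = 1 := by linear_combination (w - 1) * hw
  set E : Matrix (Fin n) (Fin n) ℂ := (1 / 3 : ℂ) • (1 + w ^ 2 • M + w • M ^ 2) with hE
  have hid : IsIdempotentElem E := by
    have h4 : M ^ 4 = M := by rw [pow_succ, h3, one_mul]
    unfold IsIdempotentElem
    have : E * E = (1 / 9 : ℂ) • (1 + (2 * w ^ 2) • M + (2 * w + w ^ 4) • M ^ 2 + (2 * w ^ 3) • M ^ 3 + w ^ 2 • M ^ 4) := by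
      rw [hE]
      have e1 : M * M = M ^ 2 := (sq M).symm
      have e2 : M * M ^ 2 = M ^ 3 := (pow_succ' M 2).symm
      have e3 : M ^ 2 * M = M ^ 3 := (pow_succ M 2).symm
      have e4 : M ^ 2 * M ^ 2 = M ^ 4 := (pow_add M 2 2).symm
      simp only [add_mul, mul_add, one_mul, mul_one, mul_smul_comm, smul_mul_assoc, e1, e2, e3, e4]
      module
    rw [this, h3, h4, hE, show w ^ 4 = w by linear_combination w * hw3, hw3]
    module
  have hp := LinearMap.IsIdempotentElem.isProj_range (Matrix.toLin' E)
    (by unfold IsIdempotentElem at *; rw [Module.End.mul_eq_comp, ← Matrix.toLin'_mul, hid])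
  have ht := hp.trace
  rw [Matrix.trace_toLin'_eq] at ht
  refine ⟨n - 3 * (Module.finrank ℂ (LinearMap.range (Matrix.toLin' E))), ?_⟩
  push_cast
  rw [← ht, hE]
  simp [h]
  linear_combination M.trace * hw

theorem arith_final {k : ℕ} (d : Fin k → ℕ) (c : Fin k → ℤ) (hd : ∀ i, 1 ≤ d i) (i0 : Fin k)
    (h0 : c i0 = d i0) (h2 : ∑ i, c i ^ 2 = 3) (h1 : ∑ i, (d i : ℤ) * c i = 0) :
    1 ≤ ∑ i, (c i : ℚ) ^ 3 / d i := by
  classical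
  have hle : ∀ i, c i ^ 2 ≤ 3 := fun i => by
    rw [← h2]
    exact Finset.single_le_sum (f := fun i => c i ^ 2) (fun j _ => sq_nonneg _) (Finset.mem_univ i)
  have hc : ∀ i, c i = 0 ∨ c i = 1 ∨ c i = -1 := fun i => by
    have := hle i
    have h1 : c i ≤ 1 := by nlinarith
    have h2 : -1 ≤ c i := by nlinarith
    omega
  have hd0 : d i0 = 1 := by
    have := hd i0
    rcases hc i0 with h | h | h <;> omega
  have hc0 : c i0 = 1 := by rw [h0, hd0]; rfl
  have hsq : ∀ i, c i ^ 2 = if c i ≠ 0 then 1 else 0 := fun i => by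
    rcases hc i with h | h | h <;> simp [h]
  set T := Finset.univ.filter (fun i => c i ≠ 0) with hT
  have hcard : T.card = 3 := by
    simp only [hsq] at h2
    rw [Finset.sum_boole] at h2
    exact_mod_cast h2
  have hi0 : i0 ∈ T := by simp [hT, hc0]
  have he : (T.erase i0).card = 2 := by rw [Finset.card_erase_of_mem hi0, hcard]
  obtain ⟨a, b, hab, hTe⟩ := Finset.card_eq_two.1 he
  have ha : a ∈ T.erase i0 := by rw [hTe]; simp
  have hb : b ∈ T.erase i0 := by rw [hTe]; simp
  have s1 : ∑ i, (d i : ℤ) * c i = 1 + (d a * c a + d b * c b) := by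
    rw [← Finset.sum_subset (Finset.subset_univ T), ← Finset.add_sum_erase _ _ hi0, hTe,
      Finset.sum_pair hab, hd0, hc0]
    · simp
    · intro i _ hi
      simp only [hT, Finset.mem_filter, Finset.mem_univ, true_and, not_not] at hi
      simp [hi]
  have s3 : ∑ i, (c i : ℚ) ^ 3 / d i = 1 + ((c a : ℚ) ^ 3 / d a + (c b : ℚ) ^ 3 / d b) := by
    rw [← Finset.sum_subset (Finset.subset_univ T), ← Finset.add_sum_erase _ _ hi0, hTe,
      Finset.sum_pair hab, hd0, hc0]
    · simp
    · intro i _ hi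
      simp only [hT, Finset.mem_filter, Finset.mem_univ, true_and, not_not] at hi
      simp [hi]
  rw [s1] at h1
  rw [s3]
  have hda := hd a
  have hdb := hd b
  have ka : c a ≠ 0 := by simp [hT] at ha; exact ha.2
  have kb : c b ≠ 0 := by simp [hT] at hb; exact hb.2
  have pa : (0 : ℚ) < d a := by exact_mod_cast hda
  have pb : (0 : ℚ) < d b := by exact_mod_cast hdb
  rcases (hc a).resolve_left ka with h | h <;> rcases (hc b).resolve_left kb with h' | h' <;>
    rw [h, h'] at h1 <;> rw [h, h'] <;> push_cast
  · omega
  · have : (d b : ℚ) ≥ d a := by exact_mod_cast (by omega : d a ≤ d b)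
    have := one_div_le_one_div_of_le pa this
    norm_num [neg_div] at *
    linarith
  · have : (d a : ℚ) ≥ d b := by exact_mod_cast (by omega : d b ≤ d a)
    have := one_div_le_one_div_of_le pb this
    norm_num [neg_div] at *
    linarith
  · omega

theorem char_lemma {G : Type*} [Group G] [Fintype G] (x : G) (X : Finset G)
    (hx : x ∈ X) (hX : Fintype.card G = 3 * X.card) (h3 : ∀ u ∈ X, u ^ 3 = 1) (hone : 1 ∉ X)
    (hinv : ∀ u ∈ X, u⁻¹ ∈ X) (hconj : ∀ g, ∀ u ∈ X, g * u * g⁻¹ ∈ X)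
    (hcl : ∀ u ∈ X, ∃ g, u = g * x * g⁻¹)
    (h : ∀ u ∈ X, ∀ v ∈ X, u * v ∈ X → v = u) : X.card ≤ 3 := by
  classical
  obtain ⟨k, d, hd, ⟨φ⟩⟩ :=
    IsSemisimpleRing.exists_algEquiv_pi_matrix_of_isAlgClosed ℂ (MonoidAlgebra ℂ G)
  set δ : G → MonoidAlgebra ℂ G := fun g => MonoidAlgebra.single g 1 with hδ
  have hδm : ∀ g h, δ g * δ h = δ (g * h) := fun g h => by simp [hδ, MonoidAlgebra.single_mul_single]
  have hδ1 : δ 1 = 1 := rfl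
  have hδc : ∀ g, (δ g).coeff 1 = if g = 1 then 1 else 0 := fun g => by
    simp [hδ, Finsupp.single_apply]
  set A : MonoidAlgebra ℂ G := ∑ u ∈ X, δ u with hA
  have c1 : A.coeff 1 = 0 := by
    rw [hA, MonoidAlgebra.coeff_sum, Finsupp.finsetSum_apply]
    refine Finset.sum_eq_zero fun u hu => ?_
    rw [hδc, if_neg]
    rintro rfl
    exact hone hu
  have c2 : (A * A).coeff 1 = X.card := by
    rw [hA, Finset.sum_mul_sum]
    simp only [hδm, MonoidAlgebra.coeff_sum, Finsupp.finsetSum_apply, hδc]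
    rw [Finset.sum_congr rfl (g := fun _ => (1 : ℂ))]
    · simp
    · intro u hu
      rw [Finset.sum_eq_single u⁻¹]
      · simp
      · intro v _ hv
        rw [if_neg]
        intro e
        exact hv (eq_inv_of_mul_eq_one_right e)
      · intro h; exact absurd (hinv u hu) h
  have c3 : (A * A * A).coeff 1 = X.card := by
    rw [hA, Finset.sum_mul_sum, Finset.sum_mul]
    simp only [Finset.sum_mul_sum, hδm, MonoidAlgebra.coeff_sum, Finsupp.finsetSum_apply, hδc]
    rw [Finset.sum_congr rfl (g := fun _ => (1 : ℂ))]
    · simp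
    · intro u hu
      rw [Finset.sum_eq_single u]
      · rw [Finset.sum_eq_single u]
        · rw [if_pos]
          rw [← h3 u hu, pow_succ, sq]
        · intro v _ hv
          rw [if_neg]
          intro e
          apply hv
          have := h3 u hu
          rw [pow_succ, sq] at this
          exact mul_left_cancel (e.trans this.symm)
        · intro h; exact absurd hu h
      · intro v hv hvu
        refine Finset.sum_eq_zero fun w hw => ?_
        rw [if_neg]
        intro e
        apply hvu
        apply h u hu v hv
        rw [eq_inv_of_mul_eq_one_left e]
        exact hinv w hw
      · intro h; exact absurd hu h
  have hAc : ∀ g, δ g * A = A * δ g := by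
    intro g
    rw [hA, Finset.mul_sum, Finset.sum_mul]
    refine Finset.sum_bij' (fun u _ => g * u * g⁻¹) (fun u _ => g⁻¹ * u * g) ?_ ?_ ?_ ?_ ?_
    · intro u hu; exact hconj g u hu
    · intro u hu; simpa using hconj g⁻¹ u hu
    · intro u hu; group
    · intro u hu; group
    · intro u hu; simp only [hδm]; congr 1; group
  have hspan : ∀ a : MonoidAlgebra ℂ G, a = ∑ g, a.coeff g • δ g := by
    intro a
    ext g
    simp [hδ, MonoidAlgebra.coeff_sum]
  have hscal : ∀ B : MonoidAlgebra ℂ G, (∀ g, δ g * B = B * δ g) →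
      ∀ i, ∃ l : ℂ, φ B i = Matrix.scalar (Fin (d i)) l := by
    intro B hB i
    have hB' : ∀ a, a * B = B * a := by
      intro a
      rw [hspan a, Finset.sum_mul, Finset.mul_sum]
      refine Finset.sum_congr rfl fun g _ => ?_
      rw [smul_mul_assoc, mul_smul_comm, hB]
    have : φ B i ∈ Set.center (Matrix (Fin (d i)) (Fin (d i)) ℂ) := by
      rw [Semigroup.mem_center_iff]
      intro M
      have := congrArg φ (hB' (φ.symm (Pi.single i M)))
      rw [map_mul, map_mul, φ.apply_symm_apply] at this
      have := congrFun this i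
      simpa using this
    rw [Matrix.center_eq_range] at this
    obtain ⟨l, hl⟩ := this
    exact ⟨l, hl.symm⟩
  choose l hl using hscal A hAc
  have htr : ∀ i, ∀ u ∈ X, (φ (δ u) i).trace = (φ (δ x) i).trace := by
    intro i u hu
    obtain ⟨g, rfl⟩ := hcl u hu
    rw [← hδm, ← hδm, map_mul, map_mul, Pi.mul_apply, Pi.mul_apply, Matrix.trace_mul_comm,
      ← mul_assoc, ← Pi.mul_apply, ← map_mul, hδm]
    simp [hδ1]
  have hIntTr : ∀ i, ∃ c : ℤ, (φ (δ x) i).trace = c := by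
    intro i
    apply trace_int
    · rw [← Pi.pow_apply, ← map_pow, pow_succ, sq, hδm, hδm, ← sq, ← pow_succ, h3 x hx, hδ1]
      simp
    · rw [← Pi.pow_apply, ← map_pow, sq, hδm]
      apply htr
      rw [show x * x = x⁻¹ by
        rw [eq_inv_iff_mul_eq_one, ← h3 x hx, pow_succ, sq]]
      exact hinv x hx
  choose c hc using hIntTr
  have hdl : ∀ i, (d i : ℂ) * l i = X.card * c i := by
    intro i
    have e : (φ A i).trace = X.card * c i := by
      rw [hA, map_sum, Finset.sum_apply, Matrix.trace_sum, Finset.sum_congr rfl (htr i), hc]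
      simp
    rw [← e, hl]
    simp [mul_comm]
  have hm : (X.card : ℂ) ≠ 0 := by
    exact_mod_cast (Finset.card_pos.2 ⟨x, hx⟩).ne'
  have hdC : ∀ i, (d i : ℂ) ≠ 0 := fun i => by
    have := (hd i).out
    exact_mod_cast this
  have t1 := trace_formula d φ A
  have t2 := trace_formula d φ (A * A)
  have t3 := trace_formula d φ (A * A * A)
  rw [c1] at t1
  rw [c2, hX] at t2
  rw [c3, hX] at t3
  simp only [map_mul, Pi.mul_apply, hl] at t1 t2 t3
  simp only [← map_mul] at t2 t3
  have tsc : ∀ i (a : ℂ), (Matrix.scalar (Fin (d i)) a).trace = d i * a := fun i a => by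
    simp
  simp only [tsc] at t1 t2 t3
  have s1 : ∑ i, (d i : ℤ) * c i = 0 := by
    have : (X.card : ℂ) * ∑ i, (d i : ℂ) * c i = 0 := by
      rw [Finset.mul_sum, ← mul_zero ((Fintype.card G : ℂ)), ← t1]
      refine Finset.sum_congr rfl fun i _ => ?_
      rw [hdl]; ring
    have := (mul_eq_zero.1 this).resolve_left hm
    exact_mod_cast this
  have s2 : ∑ i, c i ^ 2 = 3 := by
    have : (X.card : ℂ) ^ 2 * ∑ i, (c i : ℂ) ^ 2 = X.card ^ 2 * 3 := by
      rw [Finset.mul_sum]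
      push_cast at t2
      rw [show (X.card : ℂ) ^ 2 * 3 = 3 * X.card * X.card by ring, ← t2]
      refine Finset.sum_congr rfl fun i _ => ?_
      rw [← mul_pow, ← hdl]; ring
    have := mul_left_cancel₀ (pow_ne_zero 2 hm) this
    exact_mod_cast this
  have s3 : ∑ i, (c i : ℚ) ^ 3 / d i = 3 / X.card := by
    have : (X.card : ℂ) ^ 3 * ∑ i, (c i : ℂ) ^ 3 / d i = X.card ^ 3 * (3 / X.card) := by
      rw [Finset.mul_sum]
      push_cast at t3
      rw [show (X.card : ℂ) ^ 3 * (3 / X.card) = 3 * X.card * X.card by field_simp, ← t3]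
      refine Finset.sum_congr rfl fun i _ => ?_
      rw [← mul_div_assoc, ← mul_pow, ← hdl]
      have := hdC i
      field_simp
    have := mul_left_cancel₀ (pow_ne_zero 3 hm) this
    apply Rat.cast_injective (α := ℂ)
    push_cast
    exact this
  obtain ⟨i0, hi0⟩ : ∃ i0, c i0 = d i0 := by
    set S : MonoidAlgebra ℂ G := ∑ g, δ g with hS
    have hS1 : ∀ g, δ g * S = S := by
      intro g
      rw [hS, Finset.mul_sum]
      simp only [hδm]
      exact Equiv.sum_comp (Equiv.mulLeft g) δ
    have hS2 : ∀ g, S * δ g = S := by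
      intro g
      rw [hS, Finset.sum_mul]
      simp only [hδm]
      exact Equiv.sum_comp (Equiv.mulRight g) δ
    have hSne : S ≠ 0 := by
      intro h0
      have : S.coeff 1 = 0 := by rw [h0]; rfl
      rw [hS, MonoidAlgebra.coeff_sum, Finsupp.finsetSum_apply] at this
      simp [hδc] at this
    have hφ : φ S ≠ 0 := by simpa using hSne
    obtain ⟨i, hi⟩ := Function.ne_iff.1 hφ
    obtain ⟨s, hs⟩ := hscal S (fun g => by rw [hS1, hS2]) i
    have hs0 : s ≠ 0 := by
      rintro rfl
      apply hi
      rw [hs]; simp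
    refine ⟨i, ?_⟩
    have e : φ (δ x) i = 1 := by
      have := congrFun (congrArg φ (hS1 x)) i
      rw [map_mul, Pi.mul_apply, hs, Matrix.scalar_apply, ← Matrix.smul_one_eq_diagonal] at this
      rw [mul_smul_comm, mul_one] at this
      exact smul_right_injective _ hs0 this
    have := hc i
    rw [e] at this
    simp at this
    exact_mod_cast this.symm
  have fin := arith_final d c (fun i => Nat.one_le_iff_ne_zero.2 (hd i).out) i0 hi0 s2 s1
  rw [s3] at fin
  have hm' : (0 : ℚ) < X.card := by exact_mod_cast (Finset.card_pos.2 ⟨x, hx⟩)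
  rw [le_div_iff₀ hm'] at fin
  exact_mod_cast (by linarith : (X.card : ℚ) ≤ 3)

open Subgroup

theorem solv_mono {G : Type*} [Group G] {K H : Subgroup G} (h : K ≤ H) (hH : Group.IsSolvable H) :
    Group.IsSolvable K :=
  Group.isSolvable_of_isSolvable_injective (Subgroup.inclusion_injective h)

theorem solv_sup {G : Type*} [Group G] {H N : Subgroup G} (h : H ≤ normalizer (N : Set G))
    (hH : Group.IsSolvable H) (hN : Group.IsSolvable N) : Group.IsSolvable ↥(H ⊔ N) := by
  have hle : H ⊔ N ≤ normalizer (N : Set G) := sup_le h le_normalizer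
  have : (N.subgroupOf (H ⊔ N)).Normal := (normal_subgroupOf_iff_le_normalizer le_sup_right).2 hle
  have : (N.subgroupOf H).Normal := by
    rw [← inf_subgroupOf_left]
    refine ⟨fun n hn g => ?_⟩
    rw [mem_subgroupOf] at hn ⊢
    refine ⟨(g * n * g⁻¹).2, ?_⟩
    exact (mem_normalizer_iff.1 (h g.2) n).1 hn.2
  rw [Group.isSolvable_iff_subgroup_quotient (N.subgroupOf (H ⊔ N))]
  constructor
  · exact Group.isSolvable_of_isSolvable_injective (f := (subgroupOfEquivOfLe (le_sup_right : N ≤ H ⊔ N)).toMonoidHom)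
      (MulEquiv.injective _)
  · exact Group.isSolvable_of_surjective (f := (QuotientGroup.quotientInfEquivProdNormalizerQuotient H N h).toMonoidHom)
      (MulEquiv.surjective _)

theorem solv_pgroup {G : Type*} [Group G] [Finite G] {p : ℕ} [Fact p.Prime] (h : IsPGroup p G) :
    Group.IsSolvable G := by
  have := h.isNilpotent
  infer_instance

theorem solv_small {G : Type*} [Group G] [Finite G] (h : Nat.card G ≤ 9) : Group.IsSolvable G := by
  have hpos : 0 < Nat.card G := Nat.card_pos
  have pp : ∀ p n : ℕ, p.Prime → Nat.card G = p ^ n → Group.IsSolvable G := by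
    intro p n hp hc
    have := Fact.mk hp
    exact solv_pgroup (IsPGroup.of_card hc)
  by_cases h6 : Nat.card G = 6
  · have : Fact (Nat.Prime 3) := ⟨by norm_num⟩
    obtain ⟨P, hP⟩ := Sylow.exists_subgroup_card_pow_prime 3 (n := 1) (G := G) (by rw [h6]; norm_num)
    have hi : P.index = 2 := by
      have := P.card_mul_index
      rw [hP, h6] at this
      omega
    have := normal_of_index_eq_two hi
    rw [Group.isSolvable_iff_subgroup_quotient P]
    constructor
    · exact solv_pgroup (IsPGroup.of_card hP)
    · have : Fact (Nat.Prime 2) := ⟨by norm_num⟩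
      apply solv_pgroup (p := 2)
      apply IsPGroup.of_card (n := 1)
      rw [pow_one]; exact hi
  · have : Nat.card G = 2 ^ 0 ∨ Nat.card G = 2 ^ 1 ∨ Nat.card G = 3 ^ 1 ∨ Nat.card G = 2 ^ 2 ∨
      Nat.card G = 5 ^ 1 ∨ Nat.card G = 7 ^ 1 ∨ Nat.card G = 2 ^ 3 ∨ Nat.card G = 3 ^ 2 := by omega
    rcases this with h | h | h | h | h | h | h | h <;> exact pp _ _ (by norm_num) h

theorem solv_zpowers {G : Type*} [Group G] (x : G) : Group.IsSolvable (zpowers x) := by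
  apply Group.isSolvable_of_comm
  rintro ⟨a, i, rfl⟩ ⟨b, j, rfl⟩
  exact Subtype.ext (zpow_mul_comm x i j)

theorem mem_norm_closure {G : Type*} [Group G] [Finite G] (S : Set G) (g : G)
    (h : ∀ s ∈ S, g * s * g⁻¹ ∈ closure S) : g ∈ normalizer (closure S : Set G) := by
  refine mem_normalizer_fintype ?_
  intro n hn
  change n ∈ closure S at hn
  change g * n * g⁻¹ ∈ closure S
  induction hn using closure_induction with
  | mem s hs => exact h s hs
  | one => simp
  | mul a b _ _ ha hb => 
    have := mul_mem ha hb
    simpa using this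
  | inv a _ ha => 
    have := inv_mem ha
    simpa [mul_assoc] using this

theorem solv_dihedral {G : Type*} [Group G] [Finite G] {s t : G} (hs : s ^ 2 = 1) (ht : t ^ 2 = 1) :
    Group.IsSolvable (closure {s, t}) := by
  have hs' : s⁻¹ = s := by rw [inv_eq_iff_mul_eq_one, ← sq, hs]
  have ht' : t⁻¹ = t := by rw [inv_eq_iff_mul_eq_one, ← sq, ht]
  have hn : zpowers s ≤ normalizer (zpowers (s * t) : Set G) := by
    rw [zpowers_le, zpowers_eq_closure]
    apply mem_norm_closure
    intro u hu
    rw [Set.mem_singleton_iff] at hu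
    subst hu
    have : s * (s * t) * s⁻¹ = (s * t)⁻¹ := by
      rw [mul_inv_rev, hs', ht', ← mul_assoc, ← sq, hs, one_mul]
    rw [this, ← zpowers_eq_closure]
    exact inv_mem (mem_zpowers _)
  refine solv_mono ?_ (solv_sup hn (solv_zpowers _) (solv_zpowers _))
  rw [closure_le]
  rintro u (rfl | rfl)
  · exact mem_sup_left (mem_zpowers _)
  · have hm : s⁻¹ * (s * u) ∈ zpowers s ⊔ zpowers (s * u) :=
      mul_mem (inv_mem (mem_sup_left (mem_zpowers _))) (mem_sup_right (mem_zpowers _))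
    rwa [inv_mul_cancel_left] at hm

theorem solv_333 {G : Type*} [Group G] [Finite G] {u v : G} (hu : u ^ 3 = 1) (hv : v ^ 3 = 1)
    (huv : (u * v) ^ 3 = 1) : Group.IsSolvable (closure {u, v}) := by
  have hu' : u * u = u⁻¹ := by rw [eq_inv_iff_mul_eq_one, ← hu, pow_succ, sq]
  have hv' : v⁻¹ * v⁻¹ = v := by
    rw [← mul_inv_rev, inv_eq_iff_mul_eq_one, ← hv, pow_succ, sq]
  set a := u * v⁻¹ with ha
  set b := v⁻¹ * u with hb
  have hab' : a * b = u * v * u := by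
    rw [ha, hb, show u * v⁻¹ * (v⁻¹ * u) = u * (v⁻¹ * v⁻¹) * u by group, hv']
  have hba : b * a = v⁻¹ * u⁻¹ * v⁻¹ := by
    rw [ha, hb, show v⁻¹ * u * (u * v⁻¹) = v⁻¹ * (u * u) * v⁻¹ by group, hu']
  have hab : a * b = b * a := by
    rw [hab', hba]
    rw [show v⁻¹ * u⁻¹ * v⁻¹ = (v * u * v)⁻¹ by group, eq_inv_iff_mul_eq_one, ← huv, pow_succ, sq]
    group
  have hn : zpowers u ≤ normalizer (closure {a, b} : Set G) := by
    rw [zpowers_le]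
    have ma : a ∈ closure {a, b} := subset_closure (by simp)
    have mb : b ∈ closure {a, b} := subset_closure (by simp)
    apply mem_norm_closure
    rintro w (rfl | rfl)
    · have : u * a * u⁻¹ = (a * b)⁻¹ := by
        rw [hab', ha, show u * (u * v⁻¹) * u⁻¹ = (u * u) * v⁻¹ * u⁻¹ by group, hu']
        group
      rw [this]
      exact inv_mem (mul_mem ma mb)
    · have : u * b * u⁻¹ = a := by rw [hb, ha]; group
      rw [this]; exact ma
  have hcomm : Group.IsSolvable (closure {a, b}) := by
    have : ∀ x ∈ ({a, b} : Set G), ∀ y ∈ ({a, b} : Set G), x * y = y * x := by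
      rintro x (rfl | rfl) y (rfl | rfl)
      · rfl
      · exact hab
      · exact hab.symm
      · rfl
    apply Group.isSolvable_of_comm
    intro x y
    have := (closureCommGroupOfComm this).mul_comm x y
    exact this
  refine solv_mono ?_ (solv_sup hn (solv_zpowers _) hcomm)
  rw [closure_le]
  rintro w (rfl | rfl)
  · exact mem_sup_left (mem_zpowers _)
  · have hm2 : u * b⁻¹ ∈ zpowers u ⊔ closure {a, b} :=
      mul_mem (mem_sup_left (mem_zpowers _)) (inv_mem (mem_sup_right (subset_closure (by simp))))
    rwa [show u * b⁻¹ = w by rw [hb]; group] at hm2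

structure Bad {G : Type*} [Group G] (x : G) : Prop where
  ns : ¬ Group.IsSolvable G
  card : Nat.card (Sol x) ≤ 9
  sub : ∀ L : Subgroup G, x ∈ L → L ≠ ⊤ → Group.IsSolvable L
  nrm : ∀ N : Subgroup G, N.Normal → Group.IsSolvable N → N = ⊥

theorem mem_sol_of_mem {G : Type*} [Group G] {x y : G} {L : Subgroup G} (hx : x ∈ L) (hy : y ∈ L)
    (h : Group.IsSolvable L) : y ∈ Sol x := by
  change Group.IsSolvable (closure {x, y})
  refine solv_mono ?_ h
  rw [closure_le]
  rintro u (rfl | rfl) <;> assumption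

namespace Bad
variable {G : Type*} [Group G] [Finite G] {x : G}

theorem ne_top (B : Bad x) {L : Subgroup G} (h : Group.IsSolvable L) : L ≠ ⊤ := by
  rintro rfl
  exact B.ns (Group.isSolvable_of_isSolvable_injective (f := (topEquiv (G := G)).symm.toMonoidHom)
    (MulEquiv.injective _))

theorem le9' (B : Bad x) {L : Subgroup G} (hx : x ∈ L) (h : Group.IsSolvable L) :
    Nat.card L ≤ 9 := by
  have : (L : Set G) ⊆ Sol x := fun y hy => mem_sol_of_mem hx hy h
  exact (Nat.card_mono (Set.toFinite _) this).trans B.card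

theorem le9 (B : Bad x) {L : Subgroup G} (hx : x ∈ L) (h : L ≠ ⊤) : Nat.card L ≤ 9 :=
  B.le9' hx (B.sub L hx h)

theorem ne_one (B : Bad x) : x ≠ 1 := by
  rintro rfl
  have : Sol (1 : G) = Set.univ := by
    ext y
    simp only [Set.mem_univ, iff_true]
    exact mem_sol_of_mem (one_mem (zpowers y)) (mem_zpowers y) (solv_zpowers y)
  have h := B.card
  rw [this, Nat.card_univ] at h
  exact B.ns (solv_small h)

end Bad

theorem sylow_conj_le {G : Type*} [Group G] [Finite G] {p : ℕ} [Fact p.Prime] (P : Sylow p G)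
    (H : Subgroup G) (h : Nat.card P ∣ Nat.card H) :
    ∃ g : G, (P : Subgroup G) ≤ H.map (MulAut.conj g).toMonoidHom := by
  obtain ⟨n, hn⟩ := IsPGroup.iff_card.1 P.2
  have hn' : Nat.card P = p ^ n := hn
  rw [hn'] at h
  obtain ⟨R, hR⟩ := Sylow.exists_subgroup_card_pow_prime p h
  have hR' : Nat.card (R.map H.subtype) = p ^ n := by
    rw [card_map_of_injective H.subtype_injective, hR]
  obtain ⟨S, hS⟩ := (IsPGroup.of_card hR').exists_le_sylow
  obtain ⟨g, hg⟩ := MulAction.exists_smul_eq G S P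
  refine ⟨g, ?_⟩
  have hSc : Nat.card S = p ^ n := by
    rw [← hn', S.card_eq_multiplicity, P.card_eq_multiplicity]
  have hSR : R.map H.subtype = S := by
    apply eq_of_le_of_card_ge hS
    rw [hR']; exact hSc.le
  rw [← hg]
  change (S : Subgroup G).map (MulAut.conj g).toMonoidHom ≤ _
  rw [← hSR]
  exact map_mono (map_subtype_le R)

namespace Bad
variable {G : Type*} [Group G] [Finite G] {x : G}

theorem comp' (B : Bad x) {p : ℕ} [hp : Fact p.Prime] (P : Sylow p G) (hx : x ∈ P) (K : Subgroup G)
    (hK : K.Normal) (hpK : ¬ p ∣ Nat.card K) : K = ⊥ := by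
  obtain ⟨n, hn⟩ := IsPGroup.iff_card.1 P.2
  have hn' : Nat.card P = p ^ n := hn
  have hn0 : n ≠ 0 := by
    rintro rfl
    have h1 : (P : Subgroup G) = ⊥ := by
      rw [← card_eq_one]; simpa using hn
    have : x ∈ (P : Subgroup G) := hx
    rw [h1, mem_bot] at this
    exact B.ne_one this
  have key : ∀ q : ℕ, q.Prime → q ∣ Nat.card K → p * q ≤ 9 ∧ q ≠ p := by
    intro q hq hqK
    have := Fact.mk hq
    have hqp : q ≠ p := by rintro rfl; exact hpK hqK
    refine ⟨?_, hqp⟩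
    let Q : Sylow q K := default
    obtain ⟨m, hm⟩ := IsPGroup.iff_card.1 Q.2
    have hm0 : m ≠ 0 := by
      rintro rfl
      have h1 := Q.dvd_card_of_dvd_card hqK
      have hm' : Nat.card Q = q ^ 0 := hm
      rw [hm', pow_zero] at h1
      exact hq.one_lt.ne' (Nat.dvd_one.1 h1)
    set Q' : Subgroup G := (Q : Subgroup K).map K.subtype with hQ'
    have hF : normalizer (Q' : Set G) ⊔ K = ⊤ := Sylow.normalizer_sup_eq_top Q
    have hd : Nat.card P ∣ Nat.card (normalizer (Q' : Set G)) := by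
      have h1 : Nat.card P ∣ Nat.card K * K.index := by
        rw [K.card_mul_index]; exact card_subgroup_dvd_card _
      have h2 : Nat.Coprime (Nat.card P) (Nat.card K) := by
        rw [hn']
        exact Nat.Coprime.pow_left _ ((Nat.Prime.coprime_iff_not_dvd hp.1).2 hpK)
      refine (h2.dvd_of_dvd_mul_left h1).trans ?_
      rw [← relIndex_top_right, ← hF, relIndex_sup_right]
      exact index_dvd_card _
    obtain ⟨g, hg⟩ := sylow_conj_le P _ hd
    rw [map_equiv_normalizer_eq] at hg
    set Q'' : Subgroup G := Q'.map (MulAut.conj g).toMonoidHom with hQ''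
    have hQc : Nat.card Q'' = q ^ m := by
      rw [hQ'', card_map_of_injective (MulEquiv.injective _), hQ',
        card_map_of_injective K.subtype_injective]
      exact hm
    have hs : Group.IsSolvable ↥((P : Subgroup G) ⊔ Q'') :=
      solv_sup hg (solv_pgroup P.2) (solv_pgroup (IsPGroup.of_card hQc))
    have h9 := B.le9' (mem_sup_left hx) hs
    have hdvd : p * q ∣ Nat.card ↥((P : Subgroup G) ⊔ Q'') := by
      apply Nat.Coprime.mul_dvd_of_dvd_of_dvd
      · exact (Nat.coprime_primes hp.1 hq).2 hqp.symm
      · refine dvd_trans ?_ (card_dvd_of_le (le_sup_left : (P : Subgroup G) ≤ _))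
        rw [hn]; exact dvd_pow_self _ hn0
      · refine dvd_trans ?_ (card_dvd_of_le (le_sup_right : Q'' ≤ _))
        rw [hQc]; exact dvd_pow_self _ hm0
    exact (Nat.le_of_dvd Nat.card_pos hdvd).trans h9
  by_contra hne
  have hc1 : Nat.card K ≠ 1 := by rwa [Ne, card_eq_one]
  obtain ⟨q, hq, hqK⟩ := Nat.exists_prime_and_dvd hc1
  have := Fact.mk hq
  have huniq : ∀ {d : ℕ}, d.Prime → d ∣ Nat.card K → d = q := by
    intro d hd hdK
    obtain ⟨h1, h2⟩ := key q hq hqK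
    obtain ⟨h3, h4⟩ := key d hd hdK
    have a1 := hp.1.two_le
    have a2 := hq.two_le
    have a3 := hd.two_le
    have b1 : p ≤ 4 := by nlinarith
    have b2 : q ≤ 4 := by nlinarith
    have b3 : d ≤ 4 := by nlinarith
    have c1 : p ≠ 4 := by rintro rfl; exact absurd hp.1 (by norm_num)
    have c2 : q ≠ 4 := by rintro rfl; exact absurd hq (by norm_num)
    have c3 : d ≠ 4 := by rintro rfl; exact absurd hd (by norm_num)
    omega
  have := Nat.eq_prime_pow_of_unique_prime_dvd (n := Nat.card K) (p := q) Nat.card_pos.ne' huniq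
  exact hne (B.nrm K hK (solv_pgroup (IsPGroup.of_card this)))

theorem comp (B : Bad x) {p : ℕ} [hp : Fact p.Prime] (P : Sylow p G) (hx : x ∈ P)
    (h : normalizer (P : Set G) ≤ centralizer (P : Set G)) : False := by
  have h1 := MonoidHom.ker_transferSylow_isComplement' P h
  have h2 := B.comp' P hx _ inferInstance (MonoidHom.not_dvd_card_ker_transferSylow P h)
  rw [h2] at h1
  have h3 : (P : Subgroup G) = ⊤ := by simpa using h1
  exact B.ne_top (solv_pgroup P.2) h3

end Bad

theorem comm_of_norm {G : Type*} [Group G] {p : ℕ} (P : Sylow p G)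
    (h : normalizer (P : Set G) ≤ centralizer (P : Set G)) (a b : P) : a * b = b * a := by
  have h1 : (b : G) ∈ centralizer (P : Set G) := h (le_normalizer (H := (P : Subgroup G)) b.2)
  rw [mem_centralizer_iff] at h1
  exact Subtype.ext (h1 a a.2)

namespace Bad
variable {G : Type*} [Group G] [Finite G] {x : G}

theorem norm_ne_top (B : Bad x) {H : Subgroup G} (hs : Group.IsSolvable H) (hb : H ≠ ⊥) :
    normalizer (H : Set G) ≠ ⊤ := by
  intro h
  rw [normalizer_eq_top_iff] at h
  exact hb (B.nrm H h hs)

theorem six_max (B : Bad x) (h6 : orderOf x = 6) {L : Subgroup G} (hx : x ∈ L) (hL : L ≠ ⊤) :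
    L = zpowers x := by
  have h9 := B.le9 hx hL
  have hle : zpowers x ≤ L := by rwa [zpowers_le]
  have hd := card_dvd_of_le hle
  have hpos : 0 < Nat.card L := Nat.card_pos
  rw [Nat.card_zpowers, h6] at hd
  symm
  apply eq_of_le_of_card_ge hle
  rw [Nat.card_zpowers, h6]
  omega

theorem six_norm (B : Bad x) (h6 : orderOf x = 6) {y : G} (hy : y ∈ zpowers x) (hy1 : y ≠ 1) :
    normalizer (zpowers y : Set G) = zpowers x := by
  apply B.six_max h6
  · have : zpowers x ≤ centralizer (zpowers y : Set G) := by
      rintro a ⟨i, rfl⟩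
      rw [mem_centralizer_iff]
      rintro b ⟨j, rfl⟩
      obtain ⟨k, rfl⟩ := hy
      simp only [← zpow_mul]
      exact zpow_mul_comm x _ _
    have h2 := this (mem_zpowers x)
    exact centralizer_le_normalizer _ h2
  · exact B.norm_ne_top (solv_zpowers y) (by rwa [Ne, zpowers_eq_bot])

theorem six_sylow (B : Bad x) (h6 : orderOf x = 6) {p : ℕ} [hp : Fact p.Prime] {y : G}
    (hy : y ∈ zpowers x) (hyo : orderOf y = p) :
    ∃ P : Sylow p G, (P : Subgroup G) = zpowers y ∧
      normalizer (P : Set G) ≤ centralizer (P : Set G) := by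
  have hy1 : y ≠ 1 := by
    rintro rfl; rw [orderOf_one] at hyo; exact hp.1.one_lt.ne hyo
  have hn := B.six_norm h6 hy hy1
  have hyc : Nat.card (zpowers y) = p ^ 1 := by rw [Nat.card_zpowers, hyo, pow_one]
  obtain ⟨P, hP⟩ := (IsPGroup.of_card hyc).exists_le_sylow
  obtain ⟨n, hn'⟩ := IsPGroup.iff_card.1 P.2
  have hno : ¬ p ^ (1 + 1) ∣ Nat.card G := by
    intro h
    have := Sylow.prime_pow_dvd_card_normalizer h hyc
    rw [hn, Nat.card_zpowers, h6] at this
    have h1 := hp.1.two_le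
    have h2 := Nat.le_of_dvd (by norm_num) this
    have h3 : p ≤ 2 := by
      by_contra hc
      have hc3 : 3 ≤ p := by omega
      have := Nat.pow_le_pow_left hc3 (1 + 1)
      omega
    have h4 : p = 2 := by omega
    subst h4
    norm_num at this
  have hn1 : n ≤ 1 := by
    by_contra hlt
    apply hno
    refine (pow_dvd_pow p (by omega : 1 + 1 ≤ n)).trans ?_
    rw [← hn']
    exact card_subgroup_dvd_card _
  have hPe : zpowers y = P := by
    apply eq_of_le_of_card_ge hP
    rw [hn', hyc]
    exact Nat.pow_le_pow_right hp.1.pos hn1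
  refine ⟨P, hPe.symm, ?_⟩
  have h1 : normalizer (P : Set G) = zpowers x := by
    change normalizer ((P : Subgroup G) : Set G) = _
    rw [← hPe, hn]
  rw [h1]
  rintro a ⟨i, rfl⟩
  rw [mem_centralizer_iff]
  intro b hb
  have hb' : b ∈ (P : Subgroup G) := hb
  rw [← hPe] at hb'
  have : zpowers y ≤ zpowers x := by rwa [zpowers_le]
  obtain ⟨j, rfl⟩ := this hb'
  exact zpow_mul_comm x _ _

theorem six (B : Bad x) (h6 : orderOf x = 6) : False := by
  have : Fact (Nat.Prime 2) := ⟨by norm_num⟩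
  have : Fact (Nat.Prime 3) := ⟨by norm_num⟩
  have ht : orderOf (x ^ 3) = 2 := by rw [orderOf_pow, h6]; rfl
  have hs : orderOf (x ^ 2) = 3 := by rw [orderOf_pow, h6]; rfl
  have htm : x ^ 3 ∈ zpowers x := npow_mem_zpowers x 3
  have hsm : x ^ 2 ∈ zpowers x := npow_mem_zpowers x 2
  obtain ⟨P, hP, hPn⟩ := B.six_sylow h6 htm ht
  obtain ⟨Q, hQ, hQn⟩ := B.six_sylow h6 hsm hs
  have hK := MonoidHom.not_dvd_card_ker_transferSylow P hPn
  have hL := MonoidHom.not_dvd_card_ker_transferSylow Q hQn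
  set φ := MonoidHom.transferSylow P hPn
  set ψ := MonoidHom.transferSylow Q hQn
  set D := φ.ker ⊓ ψ.ker with hD
  have hDn : D.Normal := inferInstance
  have hd2 : ¬ 2 ∣ Nat.card D := fun h => hK (h.trans (card_dvd_of_le inf_le_left))
  have hd3 : ¬ 3 ∣ Nat.card D := fun h => hL (h.trans (card_dvd_of_le inf_le_right))
  have hx3 : x ^ 3 ≠ 1 := by
    intro h; rw [h, orderOf_one] at ht; omega
  have hcent : ∀ d ∈ D, x ^ 3 * d * (x ^ 3)⁻¹ = d → d = 1 := by
    intro d hd hc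
    have h1 : d ∈ zpowers x := by
      rw [← B.six_norm h6 htm hx3, zpowers_eq_closure]
      apply mem_norm_closure
      intro s hs
      rw [Set.mem_singleton_iff] at hs
      subst hs
      have : d * x ^ 3 * d⁻¹ = x ^ 3 := by
        rw [mul_inv_eq_iff_eq_mul] at hc ⊢
        exact hc.symm
      rw [this]
      exact subset_closure rfl
    have h2 : orderOf d ∣ 6 := by
      rw [← h6, ← Nat.card_zpowers x, ← Nat.card_zpowers d]
      exact card_dvd_of_le (by rwa [zpowers_le])
    have h3 : orderOf d ∣ Nat.card D := by
      rw [← Nat.card_zpowers d]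
      exact card_dvd_of_le (by rwa [zpowers_le])
    have h4 : Nat.Coprime 6 (Nat.card D) := by
      rw [show 6 = 2 * 3 by rfl]
      exact Nat.Coprime.mul_left ((Nat.Prime.coprime_iff_not_dvd Nat.prime_two).2 hd2)
        ((Nat.Prime.coprime_iff_not_dvd Nat.prime_three).2 hd3)
    rw [← orderOf_eq_one_iff]
    exact Nat.eq_one_of_dvd_coprimes h4 h2 h3
  have hx6 : x ^ 6 = 1 := by rw [← h6]; exact pow_orderOf_eq_one x
  let f : D →* D := (MulAut.conjNormal (x ^ 3) : MulAut D).toMonoidHom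
  have hff : MonoidHom.FixedPointFree f := by
    intro d hd
    apply Subtype.ext
    apply hcent d d.2
    exact congrArg Subtype.val hd
  have hfi : Function.Involutive f := by
    intro d
    apply Subtype.ext
    change x ^ 3 * (x ^ 3 * d * (x ^ 3)⁻¹) * (x ^ 3)⁻¹ = d
    have h1 : x ^ 3 * (x ^ 3 * (d : G) * (x ^ 3)⁻¹) * (x ^ 3)⁻¹ = x ^ 6 * d * (x ^ 6)⁻¹ := by group
    rw [h1, hx6]; simp
  have hcomm := MonoidHom.FixedPointFree.commute_all_of_involutive hff hfi
  have hDb := B.nrm D hDn (Group.isSolvable_of_comm fun a b => hcomm a b)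
  apply B.ns
  apply Group.isSolvable_of_comm
  intro a b
  have hm : a * b * (b * a)⁻¹ ∈ D := by
    refine ⟨?_, ?_⟩
    · change φ _ = 1
      rw [map_mul, map_inv, map_mul, map_mul, comm_of_norm P hPn (φ a), mul_inv_cancel]
    · change ψ _ = 1
      rw [map_mul, map_inv, map_mul, map_mul, comm_of_norm Q hQn (ψ a), mul_inv_cancel]
  rw [hDb, mem_bot] at hm
  exact mul_inv_eq_one.1 hm

end Bad

theorem zpowers_three {G : Type*} [Group G] {x y : G} (hx : x ^ 3 = 1) (hy : y ∈ zpowers x) :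
    y = 1 ∨ y = x ∨ y = x⁻¹ := by
  obtain ⟨i, rfl⟩ := hy
  have h3 : x ^ (3 : ℤ) = 1 := by exact_mod_cast hx
  have hq : ∀ q r : ℤ, x ^ (3 * q + r) = x ^ r := by
    intro q r
    rw [zpow_add, zpow_mul, h3, one_zpow, one_mul]
  have hi : i = 3 * (i / 3) + 0 ∨ i = 3 * (i / 3) + 1 ∨ i = 3 * (i / 3 + 1) + (-1) := by omega
  dsimp only
  rcases hi with h | h | h <;> rw [h, hq]
  · left; simp
  · right; left; simp
  · right; right; simp

namespace Bad
variable {G : Type*} [Group G] [Finite G] {x : G}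

theorem three (B : Bad x) [Fact (Nat.Prime 3)] (P : Sylow 3 G) (hx : x ∈ P)
    (hc : Nat.card P = 3) : False := by
  have hcP : Nat.card (P : Subgroup G) = 3 := hc
  by_cases hN : normalizer (P : Set G) ≤ centralizer (P : Set G)
  · exact B.comp P hx hN
  have hx1 := B.ne_one
  have hle : zpowers x ≤ P := by rw [zpowers_le]; exact hx
  have hox : orderOf x = 3 := by
    have h1 : orderOf x ∣ 3 := by
      rw [← hcP, ← Nat.card_zpowers]; exact card_dvd_of_le hle
    rcases (Nat.dvd_prime Nat.prime_three).1 h1 with h | h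
    · exact absurd (orderOf_eq_one_iff.1 h) hx1
    · exact h
  have hPe : zpowers x = P := by
    apply eq_of_le_of_card_ge hle
    rw [Nat.card_zpowers, hox, hcP]
  have hx3 : x ^ 3 = 1 := by rw [← hox]; exact pow_orderOf_eq_one x
  rw [← Sylow.coe_coe, ← hPe] at hN
  obtain ⟨g, hgN, hgC⟩ := SetLike.not_le_iff_exists.1 hN
  have hgC' : g * x * g⁻¹ ≠ x := by
    intro h
    apply hgC
    rw [mem_centralizer_iff]
    rintro _ ⟨i, rfl⟩
    have : Commute g x := mul_inv_eq_iff_eq_mul.1 h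
    exact ((this.zpow_right i).eq).symm
  have hgx : g * x * g⁻¹ = x⁻¹ := by
    have h1 : g * x * g⁻¹ ∈ zpowers x := (mem_normalizer_iff.1 hgN x).1 (mem_zpowers x)
    rcases zpowers_three hx3 h1 with h | h | h
    · rw [conj_eq_one_iff] at h; exact absurd h hx1
    · exact absurd h hgC'
    · exact h
  have hCN : centralizer {x} ≤ normalizer (zpowers x : Set G) := by
    intro c hc
    rw [mem_centralizer_singleton_iff] at hc
    rw [zpowers_eq_closure]
    apply mem_norm_closure
    intro s hs
    rw [Set.mem_singleton_iff] at hs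
    subst hs
    rw [mul_inv_eq_iff_eq_mul.2 hc]
    exact subset_closure rfl
  have hC3 : Nat.card (centralizer {x}) = 3 := by
    have hxC : zpowers x ≤ centralizer {x} := by
      rw [zpowers_le, mem_centralizer_singleton_iff]
    have h9 := B.le9 (L := normalizer (zpowers x : Set G)) (le_normalizer (mem_zpowers x))
      (B.norm_ne_top (solv_zpowers x) (by rwa [Ne, zpowers_eq_bot]))
    have d1 := card_dvd_of_le hCN
    have d2 := card_dvd_of_le hxC
    rw [Nat.card_zpowers, hox] at d2
    have hne : Nat.card (centralizer {x}) ≠ Nat.card (normalizer (zpowers x : Set G)) := by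
      intro h
      have := eq_of_le_of_card_ge hCN h.ge
      rw [← this, mem_centralizer_singleton_iff] at hgN
      exact hgC' (mul_inv_eq_iff_eq_mul.2 hgN)
    have p1 : 0 < Nat.card (normalizer (zpowers x : Set G)) := Nat.card_pos
    have p2 : 0 < Nat.card (centralizer {x}) := Nat.card_pos
    obtain ⟨k, hk⟩ := d1
    obtain ⟨l, hl⟩ := d2
    have hk2 : 2 ≤ k := by
      rcases k with _ | _ | k
      · omega
      · omega
      · omega
    have : 2 * Nat.card (centralizer {x}) ≤ 9 := by nlinarith
    omega
  have := Fintype.ofFinite G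
  classical
  let X : Finset G := Finset.univ.filter (fun u => ∃ g, u = g * x * g⁻¹)
  have hXm : ∀ u, u ∈ X ↔ ∃ g, u = g * x * g⁻¹ := by intro u; simp [X]
  have hXc : Fintype.card G = 3 * X.card := by
    have h1 := Subgroup.card_mul_index (MulAction.stabilizer (ConjAct G) x)
    rw [← nat_card_centralizer_nat_card_stabilizer, hC3, MulAction.index_stabilizer] at h1
    have h2 : MulAction.orbit (ConjAct G) x = (X : Set G) := by
      ext u
      rw [ConjAct.mem_orbit_conjAct, isConj_comm, isConj_iff, Finset.mem_coe, hXm]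
      exact ⟨fun ⟨c, h⟩ => ⟨c, h.symm⟩, fun ⟨c, h⟩ => ⟨c, h.symm⟩⟩
    rw [h2, Set.ncard_coe_finset] at h1
    rw [← Nat.card_eq_fintype_card]
    exact h1.symm
  have hX3 : ∀ u ∈ X, u ^ 3 = 1 := by
    intro u hu
    obtain ⟨h, rfl⟩ := (hXm u).1 hu
    rw [conj_pow, hx3]; simp
  have hX1 : 1 ∉ X := by
    intro h1
    obtain ⟨h, hh⟩ := (hXm 1).1 h1
    exact hx1 (conj_eq_one_iff.1 hh.symm)
  have hXconj : ∀ g, ∀ u ∈ X, g * u * g⁻¹ ∈ X := by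
    intro a u hu
    obtain ⟨h, rfl⟩ := (hXm u).1 hu
    rw [hXm]
    exact ⟨a * h, by group⟩
  have hXx : x ∈ X := by rw [hXm]; exact ⟨1, by simp⟩
  have main : ∀ v ∈ X, x * v ∈ X → v = x := by
    intro v hv hxv
    have hv1 : v ≠ 1 := by rintro rfl; exact hX1 hv
    have hs := solv_333 hx3 (hX3 v hv) (hX3 _ hxv)
    have hxL : x ∈ closure {x, v} := subset_closure (by simp)
    have hvL : v ∈ closure {x, v} := subset_closure (by simp)
    have h9 := B.le9' hxL hs
    by_cases hvP : v ∈ zpowers x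
    · rcases zpowers_three hx3 hvP with h | h | h
      · exact absurd h hv1
      · exact h
      · rw [h, mul_inv_cancel] at hxv; exact absurd hxv hX1
    · exfalso
      have hdis : Disjoint (zpowers x) (zpowers v) := by
        rw [Subgroup.disjoint_def]
        intro y hy1 hy2
        rcases zpowers_three (hX3 v hv) hy2 with h | h | h
        · exact h
        · rw [h] at hy1; exact absurd hy1 hvP
        · rw [h, inv_mem_iff] at hy1; exact absurd hy1 hvP
      have hov : orderOf v = 3 := orderOf_eq_prime (hX3 v hv) hv1
      have hinj := mul_injective_of_disjoint hdis
      let f : zpowers x × zpowers v → closure {x, v} := fun w => ⟨w.1 * w.2,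
        mul_mem ((zpowers_le.2 hxL) w.1.2) ((zpowers_le.2 hvL) w.2.2)⟩
      have hf : Function.Injective f := by
        intro a b hab
        exact hinj (congrArg Subtype.val hab)
      have hge := Nat.card_le_card_of_injective f hf
      rw [Nat.card_prod, Nat.card_zpowers, Nat.card_zpowers, hox, hov] at hge
      have hL9 : Nat.card (closure {x, v}) = 3 ^ 2 := by omega
      obtain ⟨S, hS⟩ := (IsPGroup.of_card hL9).exists_le_sylow
      have hSc : Nat.card (S : Subgroup G) = 3 := by
        rw [S.card_eq_multiplicity, ← P.card_eq_multiplicity, hc]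
      have := card_le_of_le hS
      omega
  have hfin := char_lemma x X hXx hXc hX3 hX1 ?_ hXconj (fun u hu => (hXm u).1 hu) ?_
  · apply B.ns
    apply solv_small
    rw [Nat.card_eq_fintype_card, hXc]
    omega
  · intro u hu
    obtain ⟨h, rfl⟩ := (hXm u).1 hu
    rw [hXm]
    refine ⟨h * g, ?_⟩
    rw [show h * g * x * (h * g)⁻¹ = h * (g * x * g⁻¹) * h⁻¹ by group, hgx]
    group
  · intro u hu v hv huv
    obtain ⟨h, rfl⟩ := (hXm u).1 hu
    have h1 := hXconj h⁻¹ v hv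
    have h2 := hXconj h⁻¹ _ huv
    have h3 := main _ h1 (by convert h2 using 1; group)
    rw [← h3]; group

end Bad

theorem transfer_single {G A : Type*} [Group G] [CommGroup A] {H : Subgroup G} [H.FiniteIndex]
    (φ : H →* A) {x : G} (hx : x ∈ H)
    (key : ∀ (k : ℕ) (g : G), g ∉ H → ∀ hk : g⁻¹ * x ^ k * g ∈ H, φ ⟨g⁻¹ * x ^ k * g, hk⟩ = 1) :
    MonoidHom.transfer φ x = φ ⟨x, hx⟩ := by
  classical
  have := Fintype.ofFinite (G ⧸ H)
  have : Fintype (Quotient (MulAction.orbitRel (zpowers x) (G ⧸ H))) := Fintype.ofFinite _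
  rw [MonoidHom.transfer_eq_prod_quotient_orbitRel_zpowers_quot]
  let q0 : Quotient (MulAction.orbitRel (zpowers x) (G ⧸ H)) :=
    Quotient.mk _ ((1 : G) : G ⧸ H)
  have hfix : ∀ y : G, y ∈ H → y • ((1 : G) : G ⧸ H) = ((1 : G) : G ⧸ H) := by
    intro y hy
    change ((y * 1 : G) : G ⧸ H) = _
    rw [QuotientGroup.eq]
    simpa using hy
  have hq0 : q0.out = ((1 : G) : G ⧸ H) := by
    have h1 : (MulAction.orbitRel (zpowers x) (G ⧸ H)).r q0.out ((1 : G) : G ⧸ H) :=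
      Quotient.exact (Quotient.out_eq q0)
    obtain ⟨y, hy⟩ := h1
    rw [← hy]
    exact hfix y (zpowers_le.2 hx y.2)
  rw [Fintype.prod_eq_single q0]
  · have hmem : q0.out.out ∈ H := by
      have h1 : ((q0.out.out : G) : G ⧸ H) = ((1 : G) : G ⧸ H) := by
        rw [QuotientGroup.out_eq', hq0]
      rw [QuotientGroup.eq] at h1
      simpa using h1
    have hmp : Function.minimalPeriod (fun w : G ⧸ H => x • w) q0.out = 1 := by
      rw [Function.minimalPeriod_eq_one_iff_isFixedPt]
      rw [hq0]
      exact hfix x hx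
    have h2 : (⟨q0.out.out⁻¹ * x ^ Function.minimalPeriod (fun w : G ⧸ H => x • w) q0.out
        * q0.out.out, QuotientGroup.out_conj_pow_minimalPeriod_mem H x q0.out⟩ : H) =
        (⟨q0.out.out, hmem⟩ : H)⁻¹ * ⟨x, hx⟩ * ⟨q0.out.out, hmem⟩ := by
      apply Subtype.ext
      simp [hmp]
    rw [h2, map_mul, map_mul, map_inv, mul_comm, mul_inv_cancel_left]
  · intro q hq
    apply key
    intro hmem
    apply hq
    have h1 : q.out = ((1 : G) : G ⧸ H) := by
      rw [← QuotientGroup.out_eq' q.out, QuotientGroup.eq]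
      simpa using hmem
    rw [← Quotient.out_eq q, h1]

theorem solv_of_le_pgroup {G : Type*} [Group G] [Finite G] {p : ℕ} [Fact p.Prime]
    (P : Sylow p G) {H : Subgroup G} (h : H ≤ P) : Group.IsSolvable H :=
  solv_mono h (solv_pgroup P.2)

namespace Bad
variable {G : Type*} [Group G] [Finite G] {x : G}

theorem eight_max (B : Bad x) [Fact (Nat.Prime 2)] (P : Sylow 2 G) (hx : x ∈ P)
    (hc : Nat.card (P : Subgroup G) = 8) {L : Subgroup G} (hL : L ≠ ⊤) (hP : (P : Subgroup G) ≤ L) :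
    L = P := by
  have h9 := B.le9 (hP hx) hL
  have hd := card_dvd_of_le hP
  have hpos : 0 < Nat.card L := Nat.card_pos
  rw [hc] at hd
  symm
  apply eq_of_le_of_card_ge hP
  rw [hc]
  omega

theorem sylow_ne_bot (B : Bad x) {p : ℕ} (P : Sylow p G) (hx : x ∈ P) : (P : Subgroup G) ≠ ⊥ := by
  intro h
  have hx' : x ∈ (P : Subgroup G) := hx
  rw [h, mem_bot] at hx'
  exact B.ne_one hx'

theorem eight_norm (B : Bad x) [Fact (Nat.Prime 2)] (P : Sylow 2 G) (hx : x ∈ P)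
    (hc : Nat.card (P : Subgroup G) = 8) : normalizer ((P : Subgroup G) : Set G) = P :=
  B.eight_max P hx hc (B.norm_ne_top (solv_pgroup P.2) (B.sylow_ne_bot P hx)) le_normalizer

theorem eight_sol (B : Bad x) [Fact (Nat.Prime 2)] (P : Sylow 2 G) (hx : x ∈ P)
    (hc : Nat.card (P : Subgroup G) = 8) {y : G} (hy : y ∈ Sol x) : y ∈ (P : Subgroup G) := by
  by_contra hyP
  have hx' : x ∈ (P : Subgroup G) := hx
  have hyx : y * x ∉ (P : Subgroup G) := by
    rwa [mul_mem_cancel_right hx']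
  have hyx' : y * x ∈ Sol x := by
    refine mem_sol_of_mem (L := closure {x, y}) (subset_closure (by simp)) ?_ hy
    exact mul_mem (subset_closure (by simp)) (subset_closure (by simp))
  have hsub : insert y (insert (y * x) ((P : Subgroup G) : Set G)) ⊆ Sol x := by
    rintro w (rfl | rfl | hw)
    · exact hy
    · exact hyx'
    · exact mem_sol_of_mem hx' hw (solv_pgroup P.2)
  have h1 := Set.ncard_le_ncard hsub (Set.toFinite _)
  have hc' : ((P : Subgroup G) : Set G).ncard = 8 := hc
  rw [Set.ncard_insert_of_notMem, Set.ncard_insert_of_notMem, hc'] at h1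
  · have := B.card
    rw [Nat.card_coe_set_eq] at this
    omega
  · exact hyx
  · rintro (h | h)
    · exact B.ne_one (by simpa using h.symm)
    · exact hyP h

theorem eight_two (B : Bad x) [Fact (Nat.Prime 2)] (P : Sylow 2 G) (hx : x ∈ P)
    (hc : Nat.card (P : Subgroup G) = 8) (h2 : x ^ 2 = 1) : False := by
  let S : Set G := {t | t ^ 2 = 1}
  have hle : closure S ≤ P := by
    rw [closure_le]
    intro t ht
    exact B.eight_sol P hx hc (solv_dihedral h2 ht)
  have hb : closure S ≠ ⊥ := by
    intro h
    have : x ∈ closure S := subset_closure h2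
    rw [h, mem_bot] at this
    exact B.ne_one this
  apply B.norm_ne_top (solv_of_le_pgroup P hle) hb
  rw [eq_top_iff]
  intro g _
  apply mem_norm_closure
  intro s hs
  apply Subgroup.subset_closure
  change (g * s * g⁻¹) ^ 2 = 1
  rw [conj_pow, show s ^ 2 = 1 from hs]
  simp

end Bad

theorem sq_zpow_cases {G : Type*} [Group G] {z : G} (hz : z ^ 2 = 1) (i : ℤ) :
    z ^ i = 1 ∨ z ^ i = z := by
  have h2 : z ^ (2 : ℤ) = 1 := by exact_mod_cast hz
  have hq : ∀ q r : ℤ, z ^ (2 * q + r) = z ^ r := by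
    intro q r
    rw [zpow_add, zpow_mul, h2, one_zpow, one_mul]
  have hi : i = 2 * (i / 2) + 0 ∨ i = 2 * (i / 2) + 1 := by omega
  rcases hi with h | h <;> rw [h, hq]
  · left; simp
  · right; simp

/-- In a group of order 8, the square of an element of order 4 is central. -/
theorem central_sq {P : Type*} [Group P] [Finite P] (hc : Nat.card P = 8) {x : P}
    (hx : orderOf x = 4) (h : P) : h * x ^ 2 * h⁻¹ = x ^ 2 := by
  have hx4 : x ^ 4 = 1 := by rw [← hx]; exact pow_orderOf_eq_one x
  have hz1 : x ^ 2 ≠ 1 := by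
    intro h2
    have := orderOf_dvd_of_pow_eq_one h2
    rw [hx] at this
    omega
  have hi : (zpowers x).index = 2 := by
    have := (zpowers x).card_mul_index
    rw [Nat.card_zpowers, hx, hc] at this
    omega
  have hn := normal_of_index_eq_two hi
  obtain ⟨i, hi⟩ := hn.conj_mem x (mem_zpowers x) h
  have hi' : x ^ i = h * x * h⁻¹ := hi
  have h1 : h * x ^ 2 * h⁻¹ = (x ^ 2) ^ i := by
    rw [← conj_pow, ← hi', ← zpow_natCast, ← zpow_natCast, ← zpow_mul, ← zpow_mul, mul_comm]
  have hz2 : (x ^ 2) ^ 2 = 1 := by rw [← pow_mul]; exact hx4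
  rcases sq_zpow_cases hz2 i with h2 | h2
  · rw [h2, conj_eq_one_iff] at h1
    exact absurd h1 hz1
  · rw [h1, h2]

theorem comm_quot {P : Type*} [Group P] [Finite P] (hc : Nat.card P = 8) {z : P}
    (hz : orderOf z = 2) [hN : (zpowers z).Normal] (a b : P ⧸ zpowers z) : a * b = b * a := by
  have : Fact (Nat.Prime 2) := ⟨Nat.prime_two⟩
  have h1 : Nat.card (P ⧸ zpowers z) = 2 ^ 2 := by
    have := (zpowers z).card_mul_index
    rw [Nat.card_zpowers, hz, hc] at this
    change (zpowers z).index = _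
    omega
  have := IsPGroup.isMulCommutative_of_card_eq_prime_sq h1
  exact mul_comm' a b

namespace Bad
variable {G : Type*} [Group G] [Finite G] {x : G}

/-- Weak closure of the central involution. -/
theorem eight_weak (B : Bad x) [Fact (Nat.Prime 2)] (P : Sylow 2 G) (hx : x ∈ P)
    (hc : Nat.card (P : Subgroup G) = 8) {z : G} (hzP : z ∈ (P : Subgroup G)) (hz1 : z ≠ 1)
    (hcen : ∀ h ∈ (P : Subgroup G), h * z * h⁻¹ = z)
    (hcom : ∀ h ∈ (P : Subgroup G), ∀ k ∈ (P : Subgroup G), h * k * h⁻¹ = k ∨ h * k * h⁻¹ = z * k)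
    {g : G} (hg : g * z * g⁻¹ ∈ (P : Subgroup G)) : g ∈ (P : Subgroup G) := by
  have hC : centralizer {z} = (P : Subgroup G) := by
    apply B.eight_max P hx hc
    · intro h
      refine B.norm_ne_top (H := zpowers z) (solv_zpowers z) (by rwa [Ne, zpowers_eq_bot]) ?_
      rw [eq_top_iff, ← h]
      intro c hc
      rw [mem_centralizer_singleton_iff] at hc
      rw [zpowers_eq_closure]
      apply mem_norm_closure
      intro s hs
      rw [Set.mem_singleton_iff] at hs
      subst hs
      rw [mul_inv_eq_iff_eq_mul.2 hc]
      exact subset_closure rfl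
    · intro h hh
      rw [mem_centralizer_singleton_iff]
      exact mul_inv_eq_iff_eq_mul.1 (hcen h hh)
  have maV : g * z * g⁻¹ ∈ closure {g * z * g⁻¹, z} := subset_closure (by simp)
  have mzV : z ∈ closure {g * z * g⁻¹, z} := subset_closure (by simp)
  have hVP : closure {g * z * g⁻¹, z} ≤ (P : Subgroup G) := by
    rw [closure_le]
    rintro w (rfl | rfl)
    · exact hg
    · exact hzP
  have hNV : normalizer (closure {g * z * g⁻¹, z} : Set G) = (P : Subgroup G) := by
    apply B.eight_max P hx hc
    · apply B.norm_ne_top (solv_of_le_pgroup P hVP)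
      intro h
      rw [h, mem_bot] at mzV
      exact hz1 mzV
    · intro h hh
      apply mem_norm_closure
      intro w hw
      rcases hw with hw | hw
      · rw [hw]
        rcases hcom h hh _ hg with h1 | h1
        · rw [h1]; exact maV
        · rw [h1]; exact mul_mem mzV maV
      · rw [Set.mem_singleton_iff.1 hw, hcen h hh]
        exact mzV
  have hw : g⁻¹ * z * g ∈ (P : Subgroup G) := by
    rw [← hC, mem_centralizer_singleton_iff]
    have h1 := hcen _ hg
    rw [mul_inv_eq_iff_eq_mul] at h1
    have h2 : g⁻¹ * (g * z * g⁻¹ * z) * g = g⁻¹ * (z * (g * z * g⁻¹)) * g := by rw [h1]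
    have h3 : g⁻¹ * (g * z * g⁻¹ * z) * g = z * (g⁻¹ * z * g) := by group
    have h4 : g⁻¹ * (z * (g * z * g⁻¹)) * g = g⁻¹ * z * g * z := by group
    rw [← h3, h2, h4]
  have hgN : ∀ k ∈ (P : Subgroup G), g * k * g⁻¹ ∈ (P : Subgroup G) := by
    intro k hk
    rw [← hNV]
    apply mem_norm_closure
    intro w hw'
    rcases hw' with hw' | hw'
    · rw [hw']
      have h1 : g * k * g⁻¹ * (g * z * g⁻¹) * (g * k * g⁻¹)⁻¹ = g * (k * z * k⁻¹) * g⁻¹ := by group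
      rw [h1, hcen k hk]
      exact maV
    · rw [Set.mem_singleton_iff.1 hw']
      have h1 : g * k * g⁻¹ * z * (g * k * g⁻¹)⁻¹ = g * (k * (g⁻¹ * z * g) * k⁻¹) * g⁻¹ := by group
      rw [h1]
      rcases hcom k hk _ hw with h2 | h2
      · rw [h2, show g * (g⁻¹ * z * g) * g⁻¹ = z by group]
        exact mzV
      · rw [h2, show g * (z * (g⁻¹ * z * g)) * g⁻¹ = g * z * g⁻¹ * z by group]
        exact mul_mem maV mzV
  rw [← B.eight_norm P hx hc]
  exact mem_normalizer_fintype hgN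

end Bad

theorem comm_of_card_le_four {P : Type*} [Group P] [Finite P] (h : Nat.card P ∣ 4) (a b : P) :
    a * b = b * a := by
  have : Fact (Nat.Prime 2) := ⟨Nat.prime_two⟩
  obtain ⟨k, hk, hk'⟩ := (Nat.dvd_prime_pow Nat.prime_two (m := 2)).1 h
  have : k = 0 ∨ k = 1 ∨ k = 2 := by omega
  rcases this with rfl | rfl | rfl
  · have : Subsingleton P := (Nat.card_eq_one_iff_unique.1 hk').1
    exact Subsingleton.elim _ _
  · have : IsCyclic P := isCyclic_of_prime_card (p := 2) (by simpa using hk')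
    exact IsCyclic.commGroup.mul_comm a b
  · have := IsPGroup.isMulCommutative_of_card_eq_prime_sq hk'
    exact mul_comm' a b

namespace Bad
variable {G : Type*} [Group G] [Finite G] {x : G}

theorem eight_conj (B : Bad x) [Fact (Nat.Prime 2)] (P : Sylow 2 G) (hx : x ∈ P)
    (hc : Nat.card (P : Subgroup G) = 8) {g : G} (hg : g⁻¹ * x * g ∈ (P : Subgroup G)) :
    g ∈ (P : Subgroup G) := by
  have hp : IsPGroup 2 ((P : Subgroup G).map (MulAut.conj g).toMonoidHom) := P.2.map _
  have hxm : x ∈ (P : Subgroup G).map (MulAut.conj g).toMonoidHom :=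
    ⟨g⁻¹ * x * g, hg, by simp [mul_assoc]⟩
  rw [← B.eight_norm P hx hc]
  refine mem_normalizer_fintype ?_
  intro k hk
  apply B.eight_sol P hx hc
  exact mem_sol_of_mem hxm ⟨k, hk, rfl⟩ (solv_pgroup hp)

/-- A proper normal subgroup not containing `x` but containing an element of `P`: contradiction. -/
theorem eight_fusion (B : Bad x) [Fact (Nat.Prime 2)] (P : Sylow 2 G) (hx : x ∈ P)
    (hc : Nat.card (P : Subgroup G) = 8) (N : Subgroup G) [hN : N.Normal] (hxN : x ∉ N)
    {z : G} (hzP : z ∈ (P : Subgroup G)) (hzN : z ∈ N) (hz1 : z ≠ 1) : False := by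
  have hx' : x ∈ (P : Subgroup G) := hx
  have hDp : IsPGroup 2 (((P : Subgroup G) ⊓ N).subgroupOf N) := by
    rw [inf_subgroupOf_right]
    exact P.2.comap_subtype
  obtain ⟨R, hR⟩ := hDp.exists_le_sylow
  have hR' : (R : Subgroup N).map N.subtype = (P : Subgroup G) ⊓ N := by
    symm
    have hRp : IsPGroup 2 ((R : Subgroup N).map N.subtype) := R.2.map _
    obtain ⟨S, hS⟩ := hRp.exists_le_sylow
    obtain ⟨g, hg⟩ := MulAction.exists_smul_eq G S P
    apply eq_of_le_of_card_ge
    · rintro y ⟨hy1, hy2⟩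
      exact ⟨⟨y, hy2⟩, hR (mem_subgroupOf.2 ⟨hy1, hy2⟩), rfl⟩
    · rw [← card_map_of_injective (f := (MulAut.conj g).toMonoidHom) (MulEquiv.injective _)]
      apply card_le_of_le
      rintro _ ⟨_, ⟨r, hr, rfl⟩, rfl⟩
      refine ⟨?_, hN.conj_mem _ r.2 g⟩
      rw [← hg]
      exact ⟨r, hS ⟨r, hr, rfl⟩, rfl⟩
  have hRm : ∀ n : N, n ∈ (R : Subgroup N) ↔ (n : G) ∈ (P : Subgroup G) := by
    intro n
    constructor
    · intro hn
      have : (n : G) ∈ (R : Subgroup N).map N.subtype := ⟨n, hn, rfl⟩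
      rw [hR'] at this
      exact this.1
    · intro hn
      exact hR (mem_subgroupOf.2 ⟨hn, n.2⟩)
  have hRc : Nat.card (R : Subgroup N) ∣ 4 := by
    rw [← card_map_of_injective (f := N.subtype) N.subtype_injective, hR']
    have h1 : Nat.card ↥((P : Subgroup G) ⊓ N) ∣ 8 := by
      rw [← hc]; exact card_dvd_of_le inf_le_left
    have h2 : Nat.card ↥((P : Subgroup G) ⊓ N) ≠ 8 := by
      intro h
      have h3 := eq_of_le_of_card_ge (inf_le_left : (P : Subgroup G) ⊓ N ≤ P) (by rw [h, hc])
      rw [← h3] at hx'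
      exact hxN hx'.2
    obtain ⟨k, hk, hk'⟩ := (Nat.dvd_prime_pow Nat.prime_two (m := 3)).1 h1
    rw [hk'] at h2 ⊢
    have : k ≤ 2 := by
      by_contra hlt
      have : k = 3 := by omega
      subst this
      exact h2 rfl
    exact pow_dvd_pow 2 this
  have hNG : normalizer (((P : Subgroup G) ⊓ N : Subgroup G) : Set G) = (P : Subgroup G) := by
    apply B.eight_max P hx hc
    · apply B.norm_ne_top (solv_of_le_pgroup P inf_le_left)
      intro h
      have : z ∈ (P : Subgroup G) ⊓ N := ⟨hzP, hzN⟩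
      rw [h, mem_bot] at this
      exact hz1 this
    · intro h hh
      refine mem_normalizer_fintype ?_
      rintro k ⟨hk1, hk2⟩
      have h1 : h * k * h⁻¹ ∈ (P : Subgroup G) :=
        (P : Subgroup G).mul_mem ((P : Subgroup G).mul_mem hh hk1) ((P : Subgroup G).inv_mem hh)
      exact ⟨h1, hN.conj_mem _ hk2 h⟩
  have hRn : normalizer (R : Set N) ≤ centralizer (R : Set N) := by
    intro n hn
    have hnR : n ∈ (R : Subgroup N) := by
      rw [hRm, ← hNG]
      refine mem_normalizer_fintype ?_
      rintro k ⟨hk1, hk2⟩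
      have h1 : (⟨k, hk2⟩ : N) ∈ (R : Subgroup N) := (hRm _).2 hk1
      have h2 : n * ⟨k, hk2⟩ * n⁻¹ ∈ (R : Subgroup N) := (mem_normalizer_iff.1 hn _).1 h1
      exact ⟨(hRm _).1 h2, (n * ⟨k, hk2⟩ * n⁻¹).2⟩
    rw [mem_centralizer_iff]
    intro m hm
    have := comm_of_card_le_four hRc ⟨m, hm⟩ ⟨n, hnR⟩
    exact congrArg Subtype.val this
  have hcpl := MonoidHom.ker_transferSylow_isComplement' R hRn
  have hodd := MonoidHom.not_dvd_card_ker_transferSylow R hRn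
  set ψ := MonoidHom.transferSylow R hRn with hψ
  have hKn : (ψ.ker.map N.subtype).Normal := by
    refine ⟨?_⟩
    rintro _ ⟨k, hk, rfl⟩ g
    refine ⟨MulAut.conjNormal g k, ?_, rfl⟩
    change ψ _ = 1
    rw [← orderOf_eq_one_iff]
    have h1 : orderOf (ψ (MulAut.conjNormal g k)) ∣ Nat.card ψ.ker := by
      refine (orderOf_map_dvd ψ _).trans ?_
      rw [MulEquiv.orderOf_eq]
      rw [← Nat.card_zpowers]
      exact card_dvd_of_le (zpowers_le.2 hk)
    have h2 : orderOf (ψ (MulAut.conjNormal g k)) ∣ 4 := (_root_.orderOf_dvd_natCard _).trans hRc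
    have h3 : Nat.Coprime 4 (Nat.card ψ.ker) := by
      rw [show 4 = 2 ^ 2 by rfl]
      exact Nat.Coprime.pow_left _ ((Nat.Prime.coprime_iff_not_dvd Nat.prime_two).2 hodd)
    exact Nat.eq_one_of_dvd_coprimes h3 h2 h1
  have hK := B.comp' P hx _ hKn (by rwa [card_map_of_injective N.subtype_injective])
  rw [map_eq_bot_iff_of_injective _ N.subtype_injective] at hK
  rw [hK] at hcpl
  have hRt : (R : Subgroup N) = ⊤ := by simpa using hcpl
  have hNP : N ≤ P := by
    intro n hn
    have : (⟨n, hn⟩ : N) ∈ (R : Subgroup N) := by rw [hRt]; trivial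
    exact (hRm _).1 this
  have := B.nrm N hN (solv_of_le_pgroup P hNP)
  rw [this, mem_bot] at hzN
  exact hz1 hzN

theorem eight_four (B : Bad x) [Fact (Nat.Prime 2)] (P : Sylow 2 G) (hx : x ∈ P)
    (hc : Nat.card (P : Subgroup G) = 8) (h4 : orderOf x = 4) : False := by
  have hx' : x ∈ (P : Subgroup G) := hx
  let y : (P : Subgroup G) := ⟨x, hx'⟩
  have hy4 : orderOf y = 4 := by rw [← h4]; exact (orderOf_coe y).symm
  have hz2 : orderOf (y ^ 2) = 2 := by rw [orderOf_pow, hy4]; rfl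
  have hcen := central_sq hc hy4
  have hx4 : x ^ 4 = 1 := by rw [← h4]; exact pow_orderOf_eq_one x
  have hzz : (x ^ 2) ^ 2 = 1 := by rw [← pow_mul]; exact hx4
  have hzz' : (y ^ 2) ^ 2 = 1 := Subtype.ext hzz
  have hz1 : x ^ 2 ≠ 1 := by
    intro h2
    have := orderOf_dvd_of_pow_eq_one h2
    rw [h4] at this
    omega
  have hZn : (zpowers (y ^ 2)).Normal := by
    refine ⟨?_⟩
    rintro _ ⟨i, rfl⟩ g
    refine ⟨i, ?_⟩
    dsimp only
    rw [← conj_zpow, hcen g]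
  have hq := comm_quot hc hz2
  letI : CommGroup (↥(P : Subgroup G) ⧸ zpowers (y ^ 2)) :=
    { (inferInstance : Group (↥(P : Subgroup G) ⧸ zpowers (y ^ 2))) with mul_comm := hq }
  let φ : (P : Subgroup G) →* (↥(P : Subgroup G) ⧸ zpowers (y ^ 2)) := QuotientGroup.mk' _
  have hφ : ∀ w, φ w = 1 ↔ w ∈ zpowers (y ^ 2) := fun w => QuotientGroup.eq_one_iff w
  have hcenG : ∀ h ∈ (P : Subgroup G), h * x ^ 2 * h⁻¹ = x ^ 2 := by
    intro h hh
    exact congrArg Subtype.val (hcen ⟨h, hh⟩)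
  have hcomG : ∀ h ∈ (P : Subgroup G), ∀ k ∈ (P : Subgroup G),
      h * k * h⁻¹ = k ∨ h * k * h⁻¹ = x ^ 2 * k := by
    intro h hh k hk
    have h1 : (⟨h, hh⟩ * ⟨k, hk⟩ * ⟨h, hh⟩⁻¹ * ⟨k, hk⟩⁻¹ : (P : Subgroup G)) ∈ zpowers (y ^ 2) := by
      rw [← hφ]
      simp only [map_mul, map_inv]
      rw [mul_comm (φ ⟨h, hh⟩)]
      group
    obtain ⟨i, hi⟩ := h1
    dsimp only at hi
    have hi' := hi
    rcases sq_zpow_cases hzz' i with h2 | h2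
    · rw [h2] at hi
      have h3 := congrArg Subtype.val hi
      left
      exact mul_inv_eq_one.1 h3.symm
    · rw [h2] at hi
      have h3 := congrArg Subtype.val hi
      right
      exact mul_inv_eq_iff_eq_mul.1 h3.symm
  have hweak : ∀ g : G, g * x ^ 2 * g⁻¹ ∈ (P : Subgroup G) → g ∈ (P : Subgroup G) := by
    intro g hg
    exact B.eight_weak P hx hc (pow_mem hx' 2) hz1 hcenG hcomG hg
  have htr : MonoidHom.transfer φ x = φ ⟨x, hx'⟩ := by
    apply transfer_single
    intro k g hg hk
    have hk' : k = 2 * (k / 2) ∨ k = 2 * (k / 2) + 1 := by omega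
    rcases hk' with hk2 | hk2
    · have hxk : x ^ k = (x ^ 2) ^ ((k / 2 : ℕ) : ℤ) := by
        rw [zpow_natCast, ← pow_mul, ← hk2]
      rcases sq_zpow_cases hzz ((k / 2 : ℕ) : ℤ) with h1 | h1
      · have h2 : (⟨g⁻¹ * x ^ k * g, hk⟩ : (P : Subgroup G)) = 1 := by
          apply Subtype.ext
          change g⁻¹ * x ^ k * g = 1
          rw [hxk, h1]; simp
        rw [h2, map_one]
      · exfalso
        rw [hxk, h1] at hk
        have h2 := hweak g⁻¹ (by rwa [inv_inv])
        exact hg (inv_mem_iff.1 h2)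
    · exfalso
      apply hg
      apply B.eight_conj P hx hc
      have h1 := (P : Subgroup G).pow_mem hk k
      have h2 : (g⁻¹ * x ^ k * g) ^ k = g⁻¹ * x ^ (k * k) * g := by
        have h3 := conj_pow (i := k) (a := g⁻¹) (b := x ^ k)
        rw [inv_inv] at h3
        rw [h3, ← pow_mul]
      have h3 : x ^ (k * k) = x := by
        have h5 : k * k = 4 * (k / 2 * (k / 2) + k / 2) + 1 := by
          generalize k / 2 = m at hk2
          subst hk2
          ring
        rw [h5, pow_add, pow_mul, hx4]; simp
      rwa [h2, h3] at h1
  have hφx : φ ⟨x, hx'⟩ ≠ 1 := by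
    intro h
    rw [hφ] at h
    have h1 : orderOf y ∣ orderOf (y ^ 2) := by
      rw [← Nat.card_zpowers y, ← Nat.card_zpowers (y ^ 2)]
      exact card_dvd_of_le (zpowers_le.2 h)
    rw [hy4, hz2] at h1
    omega
  refine B.eight_fusion P hx hc (MonoidHom.transfer φ).ker (z := x ^ 2) ?_ (pow_mem hx' 2) ?_ hz1
  · intro h
    exact hφx (htr.symm.trans h)
  · change MonoidHom.transfer φ (x ^ 2) = 1
    rw [map_pow, htr, ← map_pow]
    exact (hφ _).2 (mem_zpowers (y ^ 2))

theorem comp_comm (B : Bad x) {p : ℕ} [hp : Fact p.Prime] (P : Sylow p G) (hx : x ∈ P)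
    (hn : normalizer ((P : Subgroup G) : Set G) = P)
    (hcm : ∀ a b : (P : Subgroup G), a * b = b * a) : False := by
  refine B.comp P hx ?_
  change normalizer ((P : Subgroup G) : Set G) ≤ _
  rw [hn]
  intro a ha
  rw [mem_centralizer_iff]
  intro b hb
  exact congrArg Subtype.val (hcm ⟨b, hb⟩ ⟨a, ha⟩)

theorem eight (B : Bad x) [Fact (Nat.Prime 2)] (P : Sylow 2 G) (hx : x ∈ P)
    (hc : Nat.card (P : Subgroup G) = 8) : False := by
  have hle : zpowers x ≤ P := by rw [zpowers_le]; exact hx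
  have hd : orderOf x ∣ 2 ^ 3 := by
    have := card_dvd_of_le hle
    rwa [Nat.card_zpowers, hc] at this
  obtain ⟨k, hk, hk'⟩ := (Nat.dvd_prime_pow Nat.prime_two).1 hd
  have : k = 0 ∨ k = 1 ∨ k = 2 ∨ k = 3 := by omega
  rcases this with rfl | rfl | rfl | rfl
  · exact B.ne_one (orderOf_eq_one_iff.1 (by simpa using hk'))
  · exact B.eight_two P hx hc (by rw [← pow_orderOf_eq_one x, hk', pow_one])
  · exact B.eight_four P hx hc hk'
  · have hPe : zpowers x = P := by
      apply eq_of_le_of_card_ge hle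
      rw [Nat.card_zpowers, hk', hc]
      norm_num
    refine B.comp_comm P hx (B.eight_norm P hx hc) ?_
    rw [← hPe]
    rintro ⟨a, i, rfl⟩ ⟨b, j, rfl⟩
    exact Subtype.ext (zpow_mul_comm x i j)

theorem prime_power (B : Bad x) {p n : ℕ} (hp : p.Prime) (hx : orderOf x = p ^ n) : False := by
  have := Fact.mk hp
  have hxp : IsPGroup p (zpowers x) := IsPGroup.of_card (n := n) (by rw [Nat.card_zpowers, hx])
  obtain ⟨P, hP⟩ := hxp.exists_le_sylow
  have hxP : x ∈ P := hP (mem_zpowers x)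
  obtain ⟨m, hm⟩ := IsPGroup.iff_card.1 P.2
  have hbot := B.sylow_ne_bot P hxP
  have hNt := B.norm_ne_top (solv_pgroup P.2) hbot
  have hN9 := B.le9 (le_normalizer (H := (P : Subgroup G)) hxP) hNt
  have hPN := card_le_of_le (le_normalizer (H := (P : Subgroup G)))
  have hdPN := card_dvd_of_le (le_normalizer (H := (P : Subgroup G)))
  have hm0 : m ≠ 0 := by
    rintro rfl
    exact hbot (card_eq_one.1 (by simpa using hm))
  have p2 := hp.two_le
  have hNpos : 0 < Nat.card (normalizer ((P : Subgroup G) : Set G)) := Nat.card_pos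
  have hpm : p ^ m ≤ 9 := by omega
  by_cases hm1 : m = 1
  · subst hm1
    rw [pow_one] at hm hpm
    have hcyc : IsCyclic (P : Subgroup G) := isCyclic_of_prime_card hm
    have hcm : ∀ a b : (P : Subgroup G), a * b = b * a := IsCyclic.commGroup.mul_comm
    by_cases h5 : 5 ≤ p
    · refine B.comp_comm P hxP ?_ hcm
      symm
      apply eq_of_le_of_card_ge le_normalizer
      rw [hm] at hdPN ⊢
      obtain ⟨k, hk⟩ := hdPN
      rw [hk] at hN9 hNpos ⊢
      have : k < 2 := by
        by_contra hlt
        have : p * 2 ≤ p * k := Nat.mul_le_mul_left p (by omega)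
        omega
      have : k ≤ 1 := by omega
      calc p * k ≤ p * 1 := Nat.mul_le_mul_left p this
        _ = p := mul_one p
    · have p4 : p ≠ 4 := by rintro rfl; exact absurd hp (by norm_num)
      have : p = 2 ∨ p = 3 := by omega
      rcases this with rfl | rfl
      · refine B.comp P hxP ?_
        have hone : ∀ a ∈ (P : Subgroup G), a = 1 ∨ a = x := by
          intro a ha
          by_contra hcon
          rw [not_or] at hcon
          have hsub : ({1, x, a} : Set G) ⊆ ((P : Subgroup G) : Set G) := by
            rintro w (rfl | rfl | rfl)
            · exact one_mem _
            · exact hxP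
            · exact ha
          have h1 := Set.ncard_le_ncard hsub (Set.toFinite _)
          have h2 : ((P : Subgroup G) : Set G).ncard = 2 := hm
          rw [h2, Set.ncard_eq_three.2 ⟨1, x, a, B.ne_one.symm, Ne.symm hcon.1, Ne.symm hcon.2, rfl⟩] at h1
          omega
        intro g hg
        rw [mem_centralizer_iff]
        intro a ha
        rcases hone a ha with rfl | rfl
        · simp
        · have h1 : g * a * g⁻¹ ∈ (P : Subgroup G) := (mem_normalizer_iff.1 hg a).1 ha
          rcases hone _ h1 with h2 | h2
          · exact absurd (conj_eq_one_iff.1 h2) B.ne_one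
          · exact (mul_inv_eq_iff_eq_mul.1 h2).symm
      · exact B.three P hxP hm
  · have hm2 : 2 ≤ m := by omega
    have hm3 : m ≤ 3 := by
      by_contra hlt
      have h1 : 2 ^ 4 ≤ p ^ m :=
        (Nat.pow_le_pow_left p2 4).trans (Nat.pow_le_pow_right hp.pos (by omega))
      omega
    have hp3 : p ≤ 3 := by
      by_contra hlt
      have h1 : 4 ^ 2 ≤ p ^ m :=
        (Nat.pow_le_pow_left (by omega) 2).trans (Nat.pow_le_pow_right hp.pos hm2)
      omega
    by_cases hm3' : m = 3
    · subst hm3'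
      have : p = 2 := by
        by_contra hlt
        have h1 : 3 ^ 3 ≤ p ^ 3 := Nat.pow_le_pow_left (by omega) 3
        omega
      subst this
      exact B.eight P hxP hm
    · have : m = 2 := by omega
      subst this
      have := IsPGroup.isMulCommutative_of_card_eq_prime_sq hm
      refine B.comp_comm P hxP ?_ (fun a b => mul_comm' a b)
      symm
      by_contra hne
      have hlt : Nat.card (P : Subgroup G) ≠ Nat.card (normalizer ((P : Subgroup G) : Set G)) := by
        intro h
        exact hne (eq_of_le_of_card_ge le_normalizer h.ge)
      have : p = 2 ∨ p = 3 := by omega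
      rcases this with rfl | rfl
      · have hcNG := card_subgroup_dvd_card (normalizer ((P : Subgroup G) : Set G))
        rw [hm] at hdPN hlt
        have h8 : Nat.card (normalizer ((P : Subgroup G) : Set G)) = 8 := by omega
        have h1 : 2 ^ 3 ∣ Nat.card G := by
          have := card_subgroup_dvd_card (normalizer ((P : Subgroup G) : Set G))
          rwa [h8] at this
        have h2 := P.card_eq_multiplicity
        have h3 := (Nat.Prime.pow_dvd_iff_le_factorization Nat.prime_two Nat.card_pos.ne').1 h1
        have h4 : (2 : ℕ) ^ 2 = 2 ^ (Nat.card G).factorization 2 := hm.symm.trans h2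
        have h5 := Nat.pow_right_injective (le_refl 2) h4
        omega
      · rw [hm] at hdPN hlt
        omega

theorem not_bad (B : Bad x) : False := by
  have h9 := B.le9' (mem_zpowers x) (solv_zpowers x)
  rw [Nat.card_zpowers] at h9
  have hpos := orderOf_pos x
  by_cases h6 : orderOf x = 6
  · exact B.six h6
  · have : orderOf x = 2 ^ 0 ∨ orderOf x = 2 ^ 1 ∨ orderOf x = 3 ^ 1 ∨ orderOf x = 2 ^ 2 ∨
      orderOf x = 5 ^ 1 ∨ orderOf x = 7 ^ 1 ∨ orderOf x = 2 ^ 3 ∨ orderOf x = 3 ^ 2 := by omega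
    rcases this with h | h | h | h | h | h | h | h <;> exact B.prime_power (by norm_num) h

end Bad

theorem main_aux (n : ℕ) : ∀ {G : Type*} [Group G] [Finite G], Nat.card G = n →
    ¬ Group.IsSolvable G → ∀ x : G, 10 ≤ Nat.card (Sol x) := by
  induction n using Nat.strong_induction_on with
  | _ n ih =>
  intro G _ _ hn hns x
  by_contra hlt
  refine Bad.not_bad (x := x) ⟨hns, by omega, ?_, ?_⟩
  · intro L hxL hL
    by_contra hLs
    have hcard : Nat.card L < n := by
      rw [← hn]
      have h1 := card_le_card_group L
      have h2 : Nat.card L ≠ Nat.card G := fun h => hL (eq_top_of_card_eq L h)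
      omega
    have h10 := ih _ hcard rfl hLs ⟨x, hxL⟩
    have hinj : Nat.card (Sol (⟨x, hxL⟩ : L)) ≤ Nat.card (Sol x) := by
      let f : Sol (⟨x, hxL⟩ : L) → Sol x := fun y => ⟨y.1.1, by
        have hy : Group.IsSolvable (closure {(⟨x, hxL⟩ : L), y.1}) := y.2
        have h1 : Group.IsSolvable ((closure {(⟨x, hxL⟩ : L), y.1}).map L.subtype) :=
          Group.isSolvable_of_surjective (f := L.subtype.subgroupMap _)
            (L.subtype.subgroupMap_surjective _)
        exact mem_sol_of_mem (L := (closure {(⟨x, hxL⟩ : L), y.1}).map L.subtype)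
          ⟨⟨x, hxL⟩, subset_closure (by simp), rfl⟩
          ⟨y.1, subset_closure (by simp), rfl⟩ h1⟩
      apply Nat.card_le_card_of_injective f
      intro a b hab
      have h1 : (f a : G) = f b := congrArg (fun w : Sol x => (w : G)) hab
      exact Subtype.ext (Subtype.ext h1)
    omega
  · intro N hN hNs
    by_contra hNb
    have hq : ¬ Group.IsSolvable (G ⧸ N) := fun h =>
      hns ((Group.isSolvable_iff_subgroup_quotient N).2 ⟨hNs, h⟩)
    have hcard : Nat.card (G ⧸ N) < n := by
      have h1 := N.card_mul_index
      have h2 : Nat.card N ≠ 1 := by rwa [Ne, card_eq_one]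
      have h3 : 0 < Nat.card N := Nat.card_pos
      have h4 : 0 < Nat.card (G ⧸ N) := Nat.card_pos
      change Nat.card N * Nat.card (G ⧸ N) = _ at h1
      have h5 : 2 * Nat.card (G ⧸ N) ≤ Nat.card N * Nat.card (G ⧸ N) :=
        Nat.mul_le_mul_right _ (by omega)
      omega
    have h10 := ih _ hcard rfl hq (x : G ⧸ N)
    have hsub : Sol (x : G ⧸ N) ⊆ (fun y : G => (y : G ⧸ N)) '' Sol x := by
      intro w hw
      obtain ⟨y, rfl⟩ := QuotientGroup.mk_surjective w
      refine ⟨y, ?_, rfl⟩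
      have hw' : Group.IsSolvable (closure {(x : G ⧸ N), (y : G ⧸ N)}) := hw
      set M := (closure {(x : G ⧸ N), (y : G ⧸ N)}).comap (QuotientGroup.mk' N) with hM
      have hxM : x ∈ M := subset_closure (by simp)
      have hyM : y ∈ M := subset_closure (by simp)
      refine mem_sol_of_mem hxM hyM ?_
      have hNM : N ≤ M := by
        intro a ha
        change (a : G ⧸ N) ∈ closure {(x : G ⧸ N), (y : G ⧸ N)}
        rw [(QuotientGroup.eq_one_iff a).2 ha]
        exact one_mem _
      let f : M →* closure {(x : G ⧸ N), (y : G ⧸ N)} := (QuotientGroup.mk' N).subgroupComap _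
      refine Group.isSolvable_of_ker_le_range (inclusion hNM) f ?_
      intro a ha
      have h1 : ((a : G) : G ⧸ N) = 1 := congrArg Subtype.val ha
      exact ⟨⟨a, (QuotientGroup.eq_one_iff _).1 h1⟩, rfl⟩
    have h1 : Nat.card (Sol (x : G ⧸ N)) ≤ Nat.card (Sol x) :=
      (Nat.card_mono (Set.toFinite _) hsub).trans (Nat.card_image_le (Set.toFinite _))
    omega

theorem stmt15 {G : Type*} [Group G] [Finite G] (hG : ¬ IsSolvable G) (x : G) :
    10 ≤ Nat.card (Sol x) := by
  exact main_aux _ rfl hG x
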